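/- Let ((U, V, E), m, Π) be a label cover instance with label set {1,…,m} and constraint maps π_e : {1,…,m} → {1,…,m}, and let h < m be a positive integer. For each edge e ∈ E and each s ∈ {1,…,h}, let U^e(s) be a finite set (all pairwise disjoint over e and s) with subsets A^e_1(s), …, A^e_m(s) ⊆ U^e(s). For a vertex u ∈ U, label a, and class s, define S_{u,a,s} = ⋃_{e incident to u} A^e_{π_e(a)}(s); for a vertex v ∈ V, label b, and class s, define S_{v,b,s} = ⋃_{e incident to v} (U^e(s) \ A^e_b(s)). Suppose σ : U ∪ V → {1,…,m} is a labeling satisfying π_e(σ(u)) = σ(v) for every edge e = (u,v) ∈ E. Then: (i) for every edge e = (u,v), every s ∈ {1,…,h}, and every element j ∈ U^e(s), j belongs to S_{u,σ(u),s} ∪ S_{v,σ(v),s}; and (ii) for every vertex w and every residue i modulo m, there is at most one s ∈ {1,…,h} with σ(w) + s ≡ i (mod m). Consequently, the assignment that sends, for each vertex w and each s ∈ {1,…,h}, the jobs of S_{w,σ(w),s} to the machine indexed by (w, (σ(w)+s) mod m) assigns every job to some machine and places on each machine jobs from at most one of the sets S_{w,σ(w),1}, …, S_{w,σ(w),h}.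 -/

import Mathlib

open Finset
open scoped Classical

/-- completeness of the reduction: let `((U,V,E), m, Π)` be a label cover
instance (edges `Eedge` with endpoint maps `src`, `dst` and constraints `π e`), `h < m`,
and for each edge `e` and class `s ∈ {1,…,h}` (encoded by `s : Fin h`, representing
`s+1`), a finite universe `Jfib e s` with subsets `A e s i ⊆ Jfib e s` for `i ∈ [m]`; the
universes are pairwise disjoint, which is expressed by the sigma type
`JT = (e : Eedge) × (s : Fin h) × Jfib e s`.  The sets `S w a s ⊆ JT` are
`S_{u,a,s} = ⋃_{e ∋ u} A^e_{π_e(a)}(s)` and `S_{v,b,s} = ⋃_{e ∋ v} (U^e(s) \ A^e_b(s))`.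
If `σ` satisfies every edge, then: (i) every job `j ∈ U^e(s)` of an edge `e = (u,v)` lies
in `S_{u,σ(u),s} ∪ S_{v,σ(v),s}`; (ii) for every vertex `w` and residue `i` mod `m`, at
most one `s ∈ {1,…,h}` satisfies `σ(w) + s ≡ i (mod m)` (labels and classes being the
1-indexed values `σ(w)+1` and `s+1`); consequently every job is assigned to some machine
by the assignment sending `S_{w,σ(w),s}` to machine `(w, (σ(w)+s) mod m)`. -/
theorem completeness_assignment
    (U V : Type*) (Eedge : Type*) [Fintype Eedge]
    (m h : ℕ) (hh : 0 < h) (hhm : h < m)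
    (src : Eedge → U) (dst : Eedge → V)
    (π : Eedge → Fin m → Fin m)
    (Jfib : Eedge → Fin h → Type*) [∀ e s, Fintype (Jfib e s)]
    (A : (e : Eedge) → (s : Fin h) → Fin m → Finset (Jfib e s))
    (σ : U ⊕ V → Fin m)
    (hσ : ∀ e : Eedge, π e (σ (Sum.inl (src e))) = σ (Sum.inr (dst e)))
    (S : (U ⊕ V) → Fin m → Fin h → Finset ((e : Eedge) × (s : Fin h) × Jfib e s))
    (hSU : ∀ (u : U) (a : Fin m) (s : Fin h) (j : (e : Eedge) × (s : Fin h) × Jfib e s),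
      j ∈ S (Sum.inl u) a s ↔
        src j.1 = u ∧ j.2.1 = s ∧ j.2.2 ∈ A j.1 j.2.1 (π j.1 a))
    (hSV : ∀ (v : V) (b : Fin m) (s : Fin h) (j : (e : Eedge) × (s : Fin h) × Jfib e s),
      j ∈ S (Sum.inr v) b s ↔
        dst j.1 = v ∧ j.2.1 = s ∧ j.2.2 ∉ A j.1 j.2.1 b) :
    (∀ (e : Eedge) (s : Fin h) (x : Jfib e s),
        (⟨e, s, x⟩ : (e : Eedge) × (s : Fin h) × Jfib e s) ∈
          S (Sum.inl (src e)) (σ (Sum.inl (src e))) s ∪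
            S (Sum.inr (dst e)) (σ (Sum.inr (dst e))) s) ∧
      (∀ (w : U ⊕ V) (i : Fin m),
        (Finset.univ.filter (fun s : Fin h =>
          (((σ w : ℕ) + 1) + ((s : ℕ) + 1)) % m = (i : ℕ))).card ≤ 1) ∧
      (∀ j : (e : Eedge) × (s : Fin h) × Jfib e s,
        ∃ (w : U ⊕ V) (s : Fin h), j ∈ S w (σ w) s) := by
  have cover : ∀ (e : Eedge) (s : Fin h) (x : Jfib e s),
      (⟨e, s, x⟩ : (e : Eedge) × (s : Fin h) × Jfib e s) ∈
        S (Sum.inl (src e)) (σ (Sum.inl (src e))) s ∪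
          S (Sum.inr (dst e)) (σ (Sum.inr (dst e))) s := by
    intro e s x
    rw [Finset.mem_union, hSU, hSV]
    by_cases hx : x ∈ A e s (σ (Sum.inr (dst e)))
    · exact Or.inl ⟨rfl, rfl, by simpa only [hσ e] using hx⟩
    · exact Or.inr ⟨rfl, rfl, hx⟩
  refine ⟨cover, fun w i => ?_, fun ⟨e, s, x⟩ => ?_⟩
  · rw [Finset.card_le_one]
    intro a ha b hb
    rw [Finset.mem_filter] at ha hb
    have hmod : (a : ℕ) + 1 ≡ (b : ℕ) + 1 [MOD m] :=
      Nat.ModEq.add_left_cancel' ((σ w : ℕ) + 1) (ha.2.trans hb.2.symm)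
    exact Fin.ext ((Nat.ModEq.add_right_cancel' 1 hmod).eq_of_lt_of_lt
      (a.2.trans hhm) (b.2.trans hhm))
  · rcases Finset.mem_union.1 (cover e s x) with hx | hx
    · exact ⟨_, s, hx⟩
    · exact ⟨_, s, hx⟩
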